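/- arXiv:1707.03285 — 2 statements merged into one kernel-verified Lean document; each statement's English description precedes it below -/
import Mathlib

section
/- Let K be a field, let X be a finite subset of ℙ^{s−1}, and let F = {f_1,…,f_r} be a set of nonzero homogeneous polynomials of S. Then the colon ideal (I(X) : (f_1,…,f_r)) equals the vanishing ideal I(X ∖ V_X(F)) of the set of points of X at which some f_i does not vanish; here, if V_X(F) = X, the vanishing ideal of the empty set is understood to be the unit ideal S. -/
open MvPolynomial

/-- The vanishing ideal `I(X)` of a set `X` of points of the projective space `ℙ^{s-1}`:
the ideal generated by the homogeneous polynomials vanishing at all points of `X`.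
Note that for `X = ∅` this is the unit ideal (the constant `1` is homogeneous and
vacuously vanishes on `∅`). -/
noncomputable def vanishingIdeal {K : Type*} [Field K] {s : ℕ}
    (X : Set (Projectivization K (Fin s → K))) : Ideal (MvPolynomial (Fin s) K) :=
  Ideal.span {g : MvPolynomial (Fin s) K |
    (∃ d, g.IsHomogeneous d) ∧ ∀ p ∈ X, eval p.rep g = 0}

/-- `V_X(F)`, the set of zeros in `X` of a family `F` of homogeneous polynomials. -/
def projZeroSet {K : Type*} [Field K] {s r : ℕ}
    (X : Set (Projectivization K (Fin s → K))) (f : Fin r → MvPolynomial (Fin s) K) :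
    Set (Projectivization K (Fin s → K)) :=
  {p ∈ X | ∀ i, eval p.rep (f i) = 0}

/-- The restriction of polynomials to the line through `v`, parametrized by `T ↦ T • v`. -/
noncomputable def restrictLine {K : Type*} [Field K] {s : ℕ} (v : Fin s → K) :
    MvPolynomial (Fin s) K →ₐ[K] Polynomial K :=
  aeval fun i => Polynomial.C (v i) * Polynomial.X

theorem restrictLine_of_isHomogeneous {K : Type*} [Field K] {s d : ℕ} (v : Fin s → K)
    {g : MvPolynomial (Fin s) K} (hg : g.IsHomogeneous d) :
    restrictLine v g = Polynomial.C (eval v g) * Polynomial.X ^ d := by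
  rw [restrictLine, aeval_def, eval₂_eq', eval_eq', map_sum, Finset.sum_mul]
  refine Finset.sum_congr rfl fun m hm => ?_
  have hdeg : ∑ i, m i = d := by
    rw [hg.degree_eq_sum_deg_support hm, ← Finsupp.degree_eq_sum, Finsupp.degree_apply]
  simp only [mul_pow, Finset.prod_mul_distrib, Finset.prod_pow_eq_pow_sum, hdeg, map_mul,
    map_prod, map_pow, Polynomial.algebraMap_eq, mul_assoc]

theorem coeff_restrictLine {K : Type*} [Field K] {s : ℕ} (v : Fin s → K)
    (g : MvPolynomial (Fin s) K) (n : ℕ) :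
    (restrictLine v g).coeff n = eval v (homogeneousComponent n g) := by
  conv_lhs => rw [← sum_homogeneousComponent g]
  simp only [map_sum, restrictLine_of_isHomogeneous v (homogeneousComponent_isHomogeneous _ g),
    Polynomial.finsetSum_coeff, Polynomial.coeff_C_mul_X_pow, Finset.sum_ite_eq,
    Finset.mem_range]
  split_ifs with h
  · rfl
  · rw [homogeneousComponent_eq_zero n g (by omega), map_zero]

theorem mem_vanishingIdeal_iff_restrictLine {K : Type*} [Field K] {s : ℕ}
    {X : Set (Projectivization K (Fin s → K))} {g : MvPolynomial (Fin s) K} :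
    g ∈ vanishingIdeal X ↔ ∀ p ∈ X, restrictLine p.rep g = 0 := by
  constructor
  · intro hg p hp
    have hle : vanishingIdeal X ≤ RingHom.ker (restrictLine p.rep) := by
      refine Ideal.span_le.2 ?_
      rintro h ⟨⟨d, hd⟩, hz⟩
      simp [RingHom.mem_ker, restrictLine_of_isHomogeneous _ hd, hz p hp]
    exact hle hg
  · intro hg
    rw [← sum_homogeneousComponent g]
    refine Ideal.sum_mem _ fun n _ => Ideal.subset_span
      ⟨⟨n, homogeneousComponent_isHomogeneous n g⟩, fun p hp => ?_⟩
    rw [← coeff_restrictLine, hg p hp, Polynomial.coeff_zero]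

/-- Let `K` be a field, `X` a finite subset of `ℙ^{s-1}`, and
`F = {f_1, …, f_r}` a set of nonzero homogeneous polynomials of `S = K[t_1, …, t_s]`.
Then the colon ideal `(I(X) : (f_1, …, f_r))` equals the vanishing ideal
`I(X \ V_X(F))` of the set of points of `X` at which some `f_i` does not vanish
(with the convention, automatic here, that the vanishing ideal of `∅` is the unit ideal). -/
theorem stmt_2 {K : Type*} [Field K] {s r : ℕ} (hr : 0 < r)
    (X : Set (Projectivization K (Fin s → K))) (hX : X.Finite)
    (f : Fin r → MvPolynomial (Fin s) K) (hf0 : ∀ i, f i ≠ 0)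
    (hfh : ∀ i, ∃ d, (f i).IsHomogeneous d) :
    (vanishingIdeal X).colon (Ideal.span (Set.range f)) =
      vanishingIdeal (X \ projZeroSet X f) := by
  ext g
  have hline (p : Projectivization K (Fin s → K)) (i : Fin r) :
      restrictLine p.rep (f i) = 0 ↔ eval p.rep (f i) = 0 := by
    obtain ⟨d, hd⟩ := hfh i
    simp [restrictLine_of_isHomogeneous _ hd]
  have hcolon : g ∈ (vanishingIdeal X).colon (Ideal.span (Set.range f)) ↔
      ∀ i, g * f i ∈ vanishingIdeal X := by
    simp [Ideal.span, Submodule.mem_colon]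
  simp only [hcolon, mem_vanishingIdeal_iff_restrictLine, map_mul, mul_eq_zero, hline]
  constructor
  · rintro hg p ⟨hp, hpf⟩
    by_contra hne
    exact hpf ⟨hp, fun i => (hg i p hp).resolve_left hne⟩
  · intro hg i p hp
    by_cases hpf : p ∈ projZeroSet X f
    · exact Or.inr (hpf.2 i)
    · exact Or.inl (hg p ⟨hp, hpf⟩)
end

section
/- Let a = (a_1,…,a_m) be a sequence of positive integers and let r < s be indices in {1,…,m} with a_r < a_s and a_s − a_r ≥ 2. Define b by b_r = a_s, b_s = a_r and b_i = a_i for i ≠ r,s, and define b' by b'_r = a_r + 1, b'_s = a_s − 1 and b'_i = a_i for i ≠ r,s. Then π(a,b) ≥ π(a,b'). -/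
/-- For sequences `a, b` of positive integers,
`π(a,b) := ∏ a_i + ∏ b_i − ∏ min(a_i, b_i)` (as an integer). -/
def piInt {m : ℕ} (a b : Fin m → ℕ) : ℤ :=
  (∏ i, (a i : ℤ)) + (∏ i, (b i : ℤ)) - ∏ i, (min (a i) (b i) : ℤ)

/-- Split a product over a finite type into the factors at two distinct indices and the rest. -/
lemma Fintype.prod_eq_mul_mul_prod_erase_erase {ι M : Type*} [Fintype ι] [DecidableEq ι]
    [CommMonoid M] {r s : ι} (hrs : r ≠ s) (f : ι → M) :
    ∏ i, f i = f r * (f s * ∏ i ∈ (Finset.univ.erase r).erase s, f i) := by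
  rw [Finset.mul_prod_erase _ _ (by simp [hrs.symm]), Finset.mul_prod_erase _ _ (by simp)]

/-- Formula for `piInt a b` when `b` agrees with `a` away from two distinct indices. -/
lemma piInt_ite_ite {m : ℕ} (a : Fin m → ℕ) {r s : Fin m} (hrs : r ≠ s) (u v : ℕ) :
    piInt a (fun i => if i = r then u else if i = s then v else a i) =
      ((a r : ℤ) * a s + u * v - min (a r : ℤ) u * min (a s : ℤ) v) *
        ∏ i ∈ (Finset.univ.erase r).erase s, (a i : ℤ) := by
  unfold piInt
  simp only [Fintype.prod_eq_mul_mul_prod_erase_erase hrs, if_true, if_neg hrs.symm]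
  have hb : ∏ i ∈ (Finset.univ.erase r).erase s,
      ((if i = r then u else if i = s then v else a i : ℕ) : ℤ) =
      ∏ i ∈ (Finset.univ.erase r).erase s, (a i : ℤ) :=
    Finset.prod_congr rfl fun i hi => by
      simp only [Finset.mem_erase] at hi
      simp [hi.1, hi.2.1]
  have hmin : ∏ i ∈ (Finset.univ.erase r).erase s,
      min (a i : ℤ) ((if i = r then u else if i = s then v else a i : ℕ) : ℤ) =
      ∏ i ∈ (Finset.univ.erase r).erase s, (a i : ℤ) :=
    Finset.prod_congr rfl fun i hi => by
      simp only [Finset.mem_erase] at hi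
      simp [hi.1, hi.2.1]
  rw [hb, hmin]
  ring

/-- Let `a` be a sequence of positive integers and `r < s` indices with
`a_r < a_s` and `a_s − a_r ≥ 2`.  Define `b` by `b_r = a_s`, `b_s = a_r`, `b_i = a_i`
otherwise, and `b'` by `b'_r = a_r + 1`, `b'_s = a_s − 1`, `b'_i = a_i` otherwise.
Then `π(a,b) ≥ π(a,b')`. -/
theorem stmt_12 {m : ℕ} (a : Fin m → ℕ) (ha : ∀ i, 0 < a i)
    (r s : Fin m) (hrs : r < s) (h1 : a r < a s) (h2 : 2 ≤ a s - a r) :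
    piInt a (fun i => if i = r then a r + 1 else if i = s then a s - 1 else a i) ≤
      piInt a (fun i => if i = r then a s else if i = s then a r else a i) := by
  rw [piInt_ite_ite a hrs.ne, piInt_ite_ite a hrs.ne]
  refine mul_le_mul_of_nonneg_right ?_ (Finset.prod_nonneg fun i _ => Int.natCast_nonneg _)
  have hr : (1 : ℤ) ≤ a r := by exact_mod_cast ha r
  have hgap : (a r : ℤ) + 2 ≤ a s := by omega
  rw [Nat.cast_sub (by omega : 1 ≤ a s)]
  push_cast
  rw [min_eq_left (by omega : (a r : ℤ) ≤ a r + 1), min_eq_right (by omega : (a s : ℤ) - 1 ≤ a s),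
    min_eq_left (by omega : (a r : ℤ) ≤ a s), min_eq_right (by omega : (a r : ℤ) ≤ a s)]
  nlinarith [mul_nonneg (sub_nonneg.2 hr) (by omega : (0 : ℤ) ≤ a s - a r - 1)]
end
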